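/- (Jacobi–Anger expansion, sine part.) For every w ∈ ℝ and y ∈ ℝ, sin(w · sin(y)) = ∑_{m ∈ ℤ} J_{2m+1}(w) · sin((2m+1)·y), the family over m ∈ ℤ being summable. -/

import Mathlib

/-- Bessel function of the first kind of natural order `k`. -/
noncomputable def besselJNat (k : ℕ) (x : ℝ) : ℝ :=
  ∑' m : ℕ, (-1 : ℝ) ^ m / (Nat.factorial m * Nat.factorial (m + k)) * (x / 2) ^ (2 * m + k)

/-- Bessel function of the first kind of integer order `k`:
for `k < 0` it is defined as `(-1)^{-k} J_{-k}`. -/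
noncomputable def besselJ (k : ℤ) (x : ℝ) : ℝ :=
  if 0 ≤ k then besselJNat k.toNat x
  else (-1 : ℝ) ^ (-k).toNat * besselJNat (-k).toNat x

def jaEquiv : ℤ × ℕ ≃ ℕ × ℕ where
  toFun x := (x.2 + x.1.toNat, x.2 + (-x.1).toNat)
  invFun x := ((x.1 : ℤ) - x.2, min x.1 x.2)
  left_inv := by
    rintro ⟨n, m⟩
    simp only [Prod.mk.injEq]
    constructor <;> omega
  right_inv := by
    rintro ⟨p, q⟩
    simp only [Prod.mk.injEq]
    constructor <;> omega

theorem ja_term (a z : ℂ) (hz : z ≠ 0) (n : ℤ) (m : ℕ) :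
    ((a * z) ^ (m + n.toNat) / ((m + n.toNat).factorial : ℂ)) *
      ((-a * z⁻¹) ^ (m + (-n).toNat) / ((m + (-n).toNat).factorial : ℂ)) =
    (if 0 ≤ n then
      (-1 : ℂ) ^ m / (Nat.factorial m * Nat.factorial (m + n.toNat)) * a ^ (2 * m + n.toNat)
     else (-1 : ℂ) ^ (-n).toNat * ((-1 : ℂ) ^ m /
      (Nat.factorial m * Nat.factorial (m + (-n).toNat)) * a ^ (2 * m + (-n).toNat))) * z ^ n := by
  have hm : ((m.factorial : ℕ) : ℂ) ≠ 0 := by exact_mod_cast m.factorial_ne_zero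
  obtain ⟨k, rfl | rfl⟩ := n.eq_nat_or_neg
  · have hk : (((m+k).factorial : ℕ) : ℂ) ≠ 0 := by exact_mod_cast (m+k).factorial_ne_zero
    have h0 : (-(k:ℤ)).toNat = 0 := by omega
    simp only [Int.toNat_natCast, h0, Int.natCast_nonneg, if_true, zpow_natCast, add_zero]
    rw [neg_mul, neg_pow (a * z⁻¹)]
    simp only [mul_pow, inv_pow]
    field_simp
    ring
  · have hk : (((m+k).factorial : ℕ) : ℂ) ≠ 0 := by exact_mod_cast (m+k).factorial_ne_zero
    have h0 : (-(k:ℤ)).toNat = 0 := by omega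
    rcases Nat.eq_zero_or_pos k with rfl | hk0
    · simp only [Nat.cast_zero, neg_zero, Int.toNat_zero, add_zero, le_refl, if_true, zpow_zero]
      rw [neg_mul, neg_pow (a * z⁻¹)]
      simp only [mul_pow, inv_pow]
      field_simp
      ring
    · have hneg : ¬ (0 ≤ -(k:ℤ)) := by omega
      simp only [neg_neg, Int.toNat_natCast, h0, hneg, if_false, zpow_neg, zpow_natCast, add_zero]
      rw [neg_mul, neg_pow (a * z⁻¹)]
      simp only [mul_pow, inv_pow]
      field_simp
      ring

theorem ja_tsum (w : ℝ) (n : ℤ) :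
    (∑' m : ℕ, (if 0 ≤ n then
      (-1 : ℂ) ^ m / (Nat.factorial m * Nat.factorial (m + n.toNat)) * ((w:ℂ)/2) ^ (2 * m + n.toNat)
     else (-1 : ℂ) ^ (-n).toNat * ((-1 : ℂ) ^ m /
      (Nat.factorial m * Nat.factorial (m + (-n).toNat)) * ((w:ℂ)/2) ^ (2 * m + (-n).toNat)))) =
    (besselJ n w : ℂ) := by
  unfold besselJ besselJNat
  split_ifs
  · push_cast; rfl
  · rw [tsum_mul_left]; push_cast; rfl

theorem ja_single (u : ℂ) :
    HasSum (fun n : ℕ => u ^ n / (n.factorial : ℂ)) (Complex.exp u) := by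
  rw [Complex.exp_eq_exp_ℂ]
  exact NormedSpace.expSeries_div_hasSum_exp u

theorem ja_norm (u : ℂ) :
    Summable (fun n : ℕ => ‖u ^ n / (n.factorial : ℂ)‖) :=
  NormedSpace.norm_expSeries_div_summable u

theorem ja_prod (f g : ℕ → ℂ) (s t : ℂ) (hf : HasSum f s) (hg : HasSum g t)
    (hf' : Summable fun n => ‖f n‖) (hg' : Summable fun n => ‖g n‖) :
    HasSum (fun x : ℕ × ℕ => f x.1 * g x.2) (s * t) := by
  have h : Summable (fun x : ℕ × ℕ => f x.1 * g x.2) := summable_mul_of_summable_norm hf' hg'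
  exact HasSum.mul hf hg h

theorem ja_double (a z : ℂ) :
    HasSum (fun x : ℕ × ℕ => ((a * z) ^ x.1 / (x.1.factorial : ℂ)) *
      ((-a * z⁻¹) ^ x.2 / (x.2.factorial : ℂ))) (Complex.exp (a * z + -a * z⁻¹)) := by
  rw [Complex.exp_add]
  generalize a * z = u
  generalize -a * z⁻¹ = v
  exact ja_prod (fun n : ℕ => u ^ n / (n.factorial : ℂ)) (fun n : ℕ => v ^ n / (n.factorial : ℂ))
    (Complex.exp u) (Complex.exp v) (ja_single u) (ja_single v) (ja_norm u) (ja_norm v)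

theorem ja_double' (a z : ℂ) :
    HasSum (fun x : ℤ × ℕ => ((a * z) ^ (x.2 + x.1.toNat) / ((x.2 + x.1.toNat).factorial : ℂ)) *
      ((-a * z⁻¹) ^ (x.2 + (-x.1).toNat) / ((x.2 + (-x.1).toNat).factorial : ℂ)))
      (Complex.exp (a * z + -a * z⁻¹)) :=
  jaEquiv.hasSum_iff.mpr (ja_double a z)

theorem ja_gen (w : ℝ) (z : ℂ) (hz : z ≠ 0) :
    HasSum (fun n : ℤ => (besselJ n w : ℂ) * z ^ n)
      (Complex.exp ((w:ℂ)/2 * z + -((w:ℂ)/2) * z⁻¹)) := by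
  have h4 := ja_double' ((w:ℂ)/2) z
  simp only [ja_term _ z hz] at h4
  refine h4.prod_fiberwise (fun n => ?_)
  have h5 := (h4.summable.prod_factor n).hasSum
  dsimp only at h5 ⊢
  rw [tsum_mul_right, ja_tsum] at h5
  exact h5

theorem ja_exp (w y : ℝ) :
    HasSum (fun n : ℤ => (besselJ n w : ℂ) * Complex.exp (y * Complex.I) ^ n)
      (Complex.exp ((w * Real.sin y : ℝ) * Complex.I)) := by
  have h := ja_gen w _ (Complex.exp_ne_zero (y * Complex.I))
  have he : (w:ℂ)/2 * Complex.exp (y * Complex.I) + -((w:ℂ)/2) * (Complex.exp (y * Complex.I))⁻¹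
      = (w * Real.sin y : ℝ) * Complex.I := by
    rw [← Complex.exp_neg]
    push_cast
    rw [← neg_mul, Complex.exp_mul_I, Complex.exp_mul_I, Complex.cos_neg, Complex.sin_neg]
    ring
  rw [he] at h
  exact h

theorem ja_all (w y : ℝ) :
    HasSum (fun n : ℤ => besselJ n w * Real.sin (n * y)) (Real.sin (w * Real.sin y)) := by
  have h := Complex.hasSum_im (ja_exp w y)
  rw [Complex.exp_ofReal_mul_I_im] at h
  convert h using 2 with n
  rw [← Complex.exp_int_mul, ← mul_assoc, Complex.im_ofReal_mul]
  congr 1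
  rw [← Complex.exp_ofReal_mul_I_im]
  push_cast
  rfl

theorem ja_main (w y : ℝ) :
    HasSum (fun m : ℤ => besselJ (2 * m + 1) w * Real.sin ((2 * m + 1) * y))
      (Real.sin (w * Real.sin y)) := by
  have h := ((ja_all w y).sub (ja_all w (y + Real.pi))).div_const 2
  rw [Real.sin_add_pi, mul_neg, Real.sin_neg] at h
  have hinj : Function.Injective (fun m : ℤ => 2 * m + 1) := by
    intro a b hab
    simp only at hab
    omega
  rw [← hinj.hasSum_iff] at h
  · convert h using 1
    · rfl
    · funext m
      have : ((2 * m + 1 : ℤ) : ℝ) * (y + Real.pi) =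
          ((2 * m + 1) * y + Real.pi) + (m : ℝ) * (2 * Real.pi) := by push_cast; ring
      simp only [Function.comp, this, Real.sin_add_int_mul_two_pi, Real.sin_add_pi]
      push_cast
      ring
    · ring
  · intro n hn
    rcases Int.even_or_odd' n with ⟨k, rfl | rfl⟩
    · have : ((2 * k : ℤ) : ℝ) * (y + Real.pi) =
          ((2 * k : ℤ) : ℝ) * y + (k : ℝ) * (2 * Real.pi) := by push_cast; ring
      simp only [this, Real.sin_add_int_mul_two_pi]
      ring
    · exact absurd ⟨k, rfl⟩ hn

theorem jacobi_anger_sin (w y : ℝ) :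
    Summable (fun m : ℤ => besselJ (2 * m + 1) w * Real.sin ((2 * m + 1) * y)) ∧
    Real.sin (w * Real.sin y) =
      ∑' m : ℤ, besselJ (2 * m + 1) w * Real.sin ((2 * m + 1) * y) := by
  exact ⟨(ja_main w y).summable, (ja_main w y).tsum_eq.symm⟩
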